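/- Let Ω ⊂⊂ ℂⁿ be a bounded pseudoconvex domain with C^k (k ≥ 3)-smooth boundary, ρ a defining function of Ω, and L a (1,0) vector field defined on a neighborhood of ∂Ω with Lρ = 0. Then at every point p ∈ Σ_L := { p ∈ ∂Ω : Levi_ρ(L,L)(p) = 0 }, one has |Levi_ρ(L,N)|²/‖∇ρ‖² + (1/2)(N Levi_ρ(L,L))/‖∇ρ‖ = (1/4) g(∇_L ∇_{L_n} ∇ρ, L), where N := (Σ_j |∂ρ/∂z_j|²)^{-1/2} Σ_j (∂ρ/∂z̄_j) ∂/∂z_j, L_n := (Σ_j |∂ρ/∂z_j|²)^{-1} Σ_j (∂ρ/∂z̄_j) ∂/∂z_j, ∇ρ is the real gradient of ρ, g is the standard Euclidean complex Hermitian metric on ℂⁿ, and ∇ is its Levi-Civita connection. -/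

import Mathlib

open Complex
open scoped ComplexOrder

noncomputable section

/-- Points of ℂⁿ. -/
abbrev Pt (n : ℕ) := Fin n → ℂ

/-- Wirtinger derivative ∂f/∂z_j at z (junk value if f is not differentiable). -/
def dZ (n : ℕ) (f : Pt n → ℂ) (j : Fin n) (z : Pt n) : ℂ :=
  (1 / 2 : ℂ) * (fderiv ℝ f z (Pi.single j 1) - Complex.I * fderiv ℝ f z (Pi.single j Complex.I))

/-- Wirtinger derivative ∂f/∂z̄_j at z. -/
def dZb (n : ℕ) (f : Pt n → ℂ) (j : Fin n) (z : Pt n) : ℂ :=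
  (1 / 2 : ℂ) * (fderiv ℝ f z (Pi.single j 1) + Complex.I * fderiv ℝ f z (Pi.single j Complex.I))

/-- Complexification of a real-valued function. -/
def cR (n : ℕ) (ρ : Pt n → ℝ) : Pt n → ℂ := fun z => (ρ z : ℂ)

/-- Levi form of ρ at z: Levi_ρ(X,Y) = Σ_{j,k} ∂²ρ/∂z_j∂z̄_k X_j conj(Y_k), where X, Y are
(1,0)-vectors given by their coefficient tuples. -/
def levi (n : ℕ) (ρ : Pt n → ℝ) (z : Pt n) (X Y : Fin n → ℂ) : ℂ :=
  ∑ j, ∑ k, dZ n (fun w => dZb n (cR n ρ) k w) j z * X j * (starRingEnd ℂ) (Y k)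

/-- Holomorphic tangent space T^{1,0}_p(∂Ω) (for boundary points p), described via a defining
function: (1,0)-vectors X with Σ_j X_j ∂ρ/∂z_j(p) = 0. -/
def T10 (n : ℕ) (ρ : Pt n → ℝ) (p : Pt n) : Set (Fin n → ℂ) :=
  {X | ∑ j, X j * dZ n (cR n ρ) j p = 0}

/-- Null space of the Levi form inside T^{1,0}_p(∂Ω). -/
def nullSp (n : ℕ) (ρ : Pt n → ℝ) (p : Pt n) : Set (Fin n → ℂ) :=
  {X | X ∈ T10 n ρ p ∧ ∀ Y ∈ T10 n ρ p, levi n ρ p X Y = 0}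

/-- ρ is a C^s defining function of Ω on the neighborhood V of the closure of Ω. -/
def IsDefining (n : ℕ) (s : ℕ∞) (Ω : Set (Pt n)) (ρ : Pt n → ℝ) (V : Set (Pt n)) : Prop :=
  IsOpen V ∧ closure Ω ⊆ V ∧ ContDiffOn ℝ s ρ V ∧
    Ω = {z | z ∈ V ∧ ρ z < 0} ∧ ∀ z ∈ frontier Ω, fderiv ℝ ρ z ≠ 0

/-- Strict plurisubharmonicity on a set, via positivity of the Levi form. -/
def StrictPSHOn (n : ℕ) (f : Pt n → ℝ) (s : Set (Pt n)) : Prop :=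
  ∀ z ∈ s, ∀ X : Fin n → ℂ, X ≠ 0 → 0 < (levi n f z X X).re

/-- Diederich–Fornaess exponent of a defining function ρ (0 if the defining set is empty). -/
def DFexp (n : ℕ) (ρ : Pt n → ℝ) (Ω : Set (Pt n)) : ℝ :=
  sSup {η : ℝ | 0 < η ∧ η < 1 ∧ StrictPSHOn n (fun z => -((-ρ z) ^ η)) Ω}

/-- Diederich–Fornaess index of Ω: supremum over all (C¹) defining functions. -/
def DFindex (n : ℕ) (Ω : Set (Pt n)) : ℝ :=
  sSup {e : ℝ | ∃ ρ V, IsDefining n 1 Ω ρ V ∧ e = DFexp n ρ Ω}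

/-- Steinness exponent of a defining function ρ (⊤ = ∞ if the defining set is empty). -/
def Sexp (n : ℕ) (ρ : Pt n → ℝ) (Ω : Set (Pt n)) : EReal :=
  sInf {e : EReal | ∃ η : ℝ, 1 < η ∧
    (∃ U : Set (Pt n), IsOpen U ∧ frontier Ω ⊆ U ∧
      StrictPSHOn n (fun z => ρ z ^ η) ((closure Ω)ᶜ ∩ U)) ∧ e = (η : EReal)}

/-- Steinness index of Ω: infimum over all (C¹) defining functions. -/
def Sindex (n : ℕ) (Ω : Set (Pt n)) : EReal :=
  sInf {e : EReal | ∃ ρ V, IsDefining n 1 Ω ρ V ∧ e = Sexp n ρ Ω}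

/-- A complex vector field Σ_j a_j ∂/∂z_j + Σ_j b_j ∂/∂z̄_j on ℂⁿ, recorded by its
coefficient functions. -/
structure VF (n : ℕ) where
  a : Pt n → Fin n → ℂ
  b : Pt n → Fin n → ℂ

/-- Action of a complex vector field on a function. -/
def VF.app {n : ℕ} (V : VF n) (f : Pt n → ℂ) (z : Pt n) : ℂ :=
  ∑ j, V.a z j * dZ n f j z + ∑ j, V.b z j * dZb n f j z

/-- The value of a vector field at a point, as a pair ((1,0)-part, (0,1)-part). -/
def VF.atPt {n : ℕ} (V : VF n) (p : Pt n) : (Fin n → ℂ) × (Fin n → ℂ) := (V.a p, V.b p)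

/-- A complex 1-form Σ_j w_j dz_j + Σ_j t_j dz̄_j on ℂⁿ. -/
structure Form1 (n : ℕ) where
  w : Pt n → Fin n → ℂ
  t : Pt n → Fin n → ℂ

/-- Value of a 1-form at a point on a complex tangent vector (pair of (1,0) and (0,1) parts). -/
def Form1.eval {n : ℕ} (η : Form1 n) (z : Pt n) (X : (Fin n → ℂ) × (Fin n → ℂ)) : ℂ :=
  ∑ j, η.w z j * X.1 j + ∑ j, η.t z j * X.2 j

/-- Pairing of a 1-form with a vector field. -/
def Form1.app {n : ℕ} (η : Form1 n) (V : VF n) (z : Pt n) : ℂ :=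
  η.eval z (V.atPt z)

/-- Lie bracket of complex vector fields. -/
def VF.bracket {n : ℕ} (V W : VF n) : VF n :=
  ⟨fun z j => V.app (fun w => W.a w j) z - W.app (fun w => V.a w j) z,
   fun z j => V.app (fun w => W.b w j) z - W.app (fun w => V.b w j) z⟩

/-- Levi-Civita covariant derivative ∇_V W of the Euclidean metric (componentwise derivative). -/
def covD {n : ℕ} (V W : VF n) : VF n :=
  ⟨fun z j => V.app (fun w => W.a w j) z, fun z j => V.app (fun w => W.b w j) z⟩

/-- Lie derivative of a 1-form along a vector field, in coordinates. -/
def lieD {n : ℕ} (T : VF n) (η : Form1 n) : Form1 n :=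
  ⟨fun z j => T.app (fun w => η.w w j) z + ∑ m, η.w z m * dZ n (fun w => T.a w m) j z
      + ∑ m, η.t z m * dZ n (fun w => T.b w m) j z,
   fun z j => T.app (fun w => η.t w j) z + ∑ m, η.w z m * dZb n (fun w => T.a w m) j z
      + ∑ m, η.t z m * dZb n (fun w => T.b w m) j z⟩

/-- Negation of a 1-form. -/
def Form1.neg {n : ℕ} (η : Form1 n) : Form1 n := ⟨fun z j => -η.w z j, fun z j => -η.t z j⟩

/-- Σ_j |∂ρ/∂z_j|². -/
def gradSq (n : ℕ) (ρ : Pt n → ℝ) (z : Pt n) : ℝ :=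
  ∑ j, Complex.normSq (dZ n (cR n ρ) j z)

/-- Norm of the real gradient of ρ: ‖∇ρ‖ = 2 (Σ_j |∂ρ/∂z_j|²)^{1/2}. -/
def gradNorm (n : ℕ) (ρ : Pt n → ℝ) (z : Pt n) : ℝ := 2 * Real.sqrt (gradSq n ρ z)

/-- The (1,0) field L_n = (Σ|∂ρ/∂z_j|²)⁻¹ Σ_j (∂ρ/∂z̄_j) ∂/∂z_j. -/
def LnVF (n : ℕ) (ρ : Pt n → ℝ) : VF n :=
  ⟨fun z j => dZb n (cR n ρ) j z / (gradSq n ρ z : ℂ), fun _ _ => 0⟩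

/-- The (1,0) field N = (Σ|∂ρ/∂z_j|²)^{-1/2} Σ_j (∂ρ/∂z̄_j) ∂/∂z_j. -/
def NVF (n : ℕ) (ρ : Pt n → ℝ) : VF n :=
  ⟨fun z j => dZb n (cR n ρ) j z / ((Real.sqrt (gradSq n ρ z) : ℝ) : ℂ), fun _ _ => 0⟩

/-- T = L_n − conj(L_n). -/
def TVF (n : ℕ) (ρ : Pt n → ℝ) : VF n :=
  ⟨fun z j => (LnVF n ρ).a z j, fun z j => -(starRingEnd ℂ) ((LnVF n ρ).a z j)⟩

/-- η = (1/2)(∂ρ − ∂̄ρ). -/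
def etaF (n : ℕ) (ρ : Pt n → ℝ) : Form1 n :=
  ⟨fun z j => (1 / 2 : ℂ) * dZ n (cR n ρ) j z,
   fun z j => -(1 / 2 : ℂ) * dZb n (cR n ρ) j z⟩

/-- The D'Angelo 1-form α_ρ = −Lie_T η of a defining function ρ. -/
def dAngelo (n : ℕ) (ρ : Pt n → ℝ) : Form1 n := Form1.neg (lieD (TVF n ρ) (etaF n ρ))

/-- Evaluation of the (1,0)-part ∂η of the exterior derivative of a 1-form on two
complex tangent vectors. -/
def delEval {n : ℕ} (η : Form1 n) (X Y : (Fin n → ℂ) × (Fin n → ℂ)) (z : Pt n) : ℂ :=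
  (∑ m, ∑ l, dZ n (fun w => η.w w l) m z * (X.1 m * Y.1 l - Y.1 m * X.1 l)) +
  (∑ m, ∑ l, dZ n (fun w => η.t w l) m z * (X.1 m * Y.2 l - Y.1 m * X.2 l))

/-- Evaluation of ∂̄η of a 1-form η on two complex tangent vectors. -/
def delbEval {n : ℕ} (η : Form1 n) (X Y : (Fin n → ℂ) × (Fin n → ℂ)) (z : Pt n) : ℂ :=
  (∑ m, ∑ l, dZb n (fun w => η.w w l) m z * (X.2 m * Y.1 l - Y.2 m * X.1 l)) +
  (∑ m, ∑ l, dZb n (fun w => η.t w l) m z * (X.2 m * Y.2 l - Y.2 m * X.2 l))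

/-- Evaluation of dη = ∂η + ∂̄η. -/
def dEval {n : ℕ} (η : Form1 n) (X Y : (Fin n → ℂ) × (Fin n → ℂ)) (z : Pt n) : ℂ :=
  delEval η X Y z + delbEval η X Y z

/-- Evaluation of d^c η = i(∂̄ − ∂)η. -/
def dcEval {n : ℕ} (η : Form1 n) (X Y : (Fin n → ℂ) × (Fin n → ℂ)) (z : Pt n) : ℂ :=
  Complex.I * (delbEval η X Y z - delEval η X Y z)

/-- Evaluation of ω ∧ ω̄ on two complex tangent vectors, where ω = π_{1,0} η is the
(1,0)-component of the real 1-form η. -/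
def omegaWedge {n : ℕ} (η : Form1 n) (X Y : (Fin n → ℂ) × (Fin n → ℂ)) (z : Pt n) : ℂ :=
  (∑ j, η.w z j * X.1 j) * (∑ j, (starRingEnd ℂ) (η.w z j) * Y.2 j) -
  (∑ j, η.w z j * Y.1 j) * (∑ j, (starRingEnd ℂ) (η.w z j) * X.2 j)

/-- Evaluation of ∂̄ω where ω = π_{1,0} η. -/
def delbOmega {n : ℕ} (η : Form1 n) (X Y : (Fin n → ℂ) × (Fin n → ℂ)) (z : Pt n) : ℂ :=
  delbEval ⟨η.w, fun _ _ => 0⟩ X Y z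

/-- The standard Euclidean complex Hermitian metric g on complexified tangent vectors
(so that g(∂/∂z_j, ∂/∂z_j) = 1/2). -/
def gMet {n : ℕ} (X Y : (Fin n → ℂ) × (Fin n → ℂ)) : ℂ :=
  (1 / 2 : ℂ) * (∑ j, X.1 j * (starRingEnd ℂ) (Y.1 j) + ∑ j, X.2 j * (starRingEnd ℂ) (Y.2 j))

/-- The real gradient ∇ρ as a complex vector field: 2Σ_j (∂ρ/∂z̄_j ∂/∂z_j + ∂ρ/∂z_j ∂/∂z̄_j). -/
def gradVF (n : ℕ) (ρ : Pt n → ℝ) : VF n :=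
  ⟨fun z j => 2 * dZb n (cR n ρ) j z, fun z j => 2 * dZ n (cR n ρ) j z⟩

/-- Pseudoconvexity of Ω (w.r.t. the defining function ρ): the Levi form is positive
semidefinite on the holomorphic tangent spaces of the boundary. -/
def LeviPseudoconvex (n : ℕ) (ρ : Pt n → ℝ) (Ω : Set (Pt n)) : Prop :=
  ∀ p ∈ frontier Ω, ∀ X ∈ T10 n ρ p, 0 ≤ (levi n ρ p X X).re

/-- The set Σ of weakly pseudoconvex boundary points. -/
def weakPts (n : ℕ) (ρ : Pt n → ℝ) (Ω : Set (Pt n)) : Set (Pt n) :=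
  {p | p ∈ frontier Ω ∧ ∃ X ∈ T10 n ρ p, X ≠ 0 ∧ levi n ρ p X X = 0}

/-- Action of a complex tangent vector at p on a function. -/
def vecApp (n : ℕ) (X : (Fin n → ℂ) × (Fin n → ℂ)) (f : Pt n → ℂ) (p : Pt n) : ℂ :=
  ∑ j, X.1 j * dZ n f j p + ∑ j, X.2 j * dZb n f j p

/-- Pushforward (complexified differential) of a complex tangent vector at p by a map f. -/
def push (n : ℕ) (f : Pt n → Pt n) (p : Pt n) (X : (Fin n → ℂ) × (Fin n → ℂ)) :
    (Fin n → ℂ) × (Fin n → ℂ) :=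
  (fun l => vecApp n X (fun w => f w l) p,
   fun l => vecApp n X (fun w => (starRingEnd ℂ) (f w l)) p)

/-- Conjugation of a coefficient tuple. -/
def conjVec {n : ℕ} (X : Fin n → ℂ) : Fin n → ℂ := fun j => (starRingEnd ℂ) (X j)

/-- A C^k CR-diffeomorphism between ∂Ω₁ and ∂Ω₂, presented by a C^k map f on a
neighborhood U₁ of ∂Ω₁ together with a C^k local inverse g: f maps ∂Ω₁ onto ∂Ω₂
diffeomorphically and its differential maps T^{1,0}(∂Ω₁) into T^{1,0}(∂Ω₂). -/
def IsCRDiffeo (n : ℕ) (k : ℕ∞) (Ω₁ Ω₂ : Set (Pt n)) (ρ₁ ρ₂ : Pt n → ℝ)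
    (f g : Pt n → Pt n) (U₁ U₂ : Set (Pt n)) : Prop :=
  IsOpen U₁ ∧ IsOpen U₂ ∧ frontier Ω₁ ⊆ U₁ ∧ frontier Ω₂ ⊆ U₂ ∧
  (∀ l, ContDiffOn ℝ k (fun z => f z l) U₁) ∧
  (∀ l, ContDiffOn ℝ k (fun z => g z l) U₂) ∧
  f '' frontier Ω₁ = frontier Ω₂ ∧
  (∀ p ∈ frontier Ω₁, g (f p) = p) ∧ (∀ q ∈ frontier Ω₂, f (g q) = q) ∧
  (∀ p ∈ frontier Ω₁, ∀ L ∈ T10 n ρ₁ p,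
    (push n f p (L, 0)).2 = 0 ∧ (push n f p (L, 0)).1 ∈ T10 n ρ₂ (f p))

/-- The 1-form d^c ψ = i(∂̄ψ − ∂ψ) of a real function ψ. -/
def dcForm (n : ℕ) (ψ : Pt n → ℝ) : Form1 n :=
  ⟨fun z j => -Complex.I * dZ n (cR n ψ) j z, fun z j => Complex.I * dZb n (cR n ψ) j z⟩

end

section Wirtinger

variable {n : ℕ}

lemma dZ_congr {f g : Pt n → ℂ} {z : Pt n} (h : f =ᶠ[nhds z] g) (j : Fin n) :
    dZ n f j z = dZ n g j z := by
  simp only [dZ, h.fderiv_eq]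

lemma dZ_const (c : ℂ) (j : Fin n) (z : Pt n) : dZ n (fun _ => c) j z = 0 := by
  simp [dZ]

lemma dZ_mul {f g : Pt n → ℂ} {z : Pt n} (hf : DifferentiableAt ℝ f z)
    (hg : DifferentiableAt ℝ g z) (j : Fin n) :
    dZ n (fun w => f w * g w) j z = dZ n f j z * g z + f z * dZ n g j z := by
  simp only [dZ, fderiv_fun_mul hf hg, _root_.add_apply,
    _root_.smul_apply, smul_eq_mul]
  ring

lemma dZ_sum {ι : Type*} (s : Finset ι) {f : ι → Pt n → ℂ} {z : Pt n}
    (hf : ∀ i ∈ s, DifferentiableAt ℝ (f i) z) (j : Fin n) :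
    dZ n (fun w => ∑ i ∈ s, f i w) j z = ∑ i ∈ s, dZ n (f i) j z := by
  simp only [dZ, fderiv_fun_sum hf, _root_.sum_apply, Finset.mul_sum,
    ← Finset.sum_sub_distrib]

lemma dZ_const_mul (c : ℂ) {f : Pt n → ℂ} {z : Pt n} (hf : DifferentiableAt ℝ f z)
    (j : Fin n) : dZ n (fun w => c * f w) j z = c * dZ n f j z := by
  rw [dZ_mul (differentiableAt_const c) hf, dZ_const]
  ring

lemma fderiv_conj_apply (f : Pt n → ℂ) (z v : Pt n) :
    fderiv ℝ (fun w => (starRingEnd ℂ) (f w)) z v = (starRingEnd ℂ) (fderiv ℝ f z v) := by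
  have h := Complex.conjCLE.comp_fderiv (f := f) (x := z)
  have h' := congrArg (fun T : Pt n →L[ℝ] ℂ => T v) h
  simpa [Function.comp_def] using h'

lemma conj_dZ (f : Pt n → ℂ) (j : Fin n) (z : Pt n) :
    (starRingEnd ℂ) (dZ n f j z) = dZb n (fun w => (starRingEnd ℂ) (f w)) j z := by
  simp [dZ, dZb, fderiv_conj_apply, Complex.conj_ofNat]

lemma conj_dZb (f : Pt n → ℂ) (j : Fin n) (z : Pt n) :
    (starRingEnd ℂ) (dZb n f j z) = dZ n (fun w => (starRingEnd ℂ) (f w)) j z := by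
  simp [dZ, dZb, fderiv_conj_apply, Complex.conj_ofNat, sub_eq_add_neg]

lemma conj_dZ_cR (ρ : Pt n → ℝ) (j : Fin n) (z : Pt n) :
    (starRingEnd ℂ) (dZ n (cR n ρ) j z) = dZb n (cR n ρ) j z := by
  rw [conj_dZ]
  congr 1
  ext w
  simp [cR]

lemma conj_dZb_cR (ρ : Pt n → ℝ) (j : Fin n) (z : Pt n) :
    (starRingEnd ℂ) (dZb n (cR n ρ) j z) = dZ n (cR n ρ) j z := by
  rw [← conj_dZ_cR, Complex.conj_conj]

lemma ContDiffAt.fderiv_apply_const {f : Pt n → ℂ} {z : Pt n} {m k : WithTop ℕ∞}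
    (hf : ContDiffAt ℝ k f z) (hmk : m + 1 ≤ k) (v : Pt n) :
    ContDiffAt ℝ m (fun w => fderiv ℝ f w v) z :=
  (hf.fderiv_right hmk).clm_apply contDiffAt_const

lemma ContDiffAt.dZ {f : Pt n → ℂ} {z : Pt n} {m k : WithTop ℕ∞}
    (hf : ContDiffAt ℝ k f z) (hmk : m + 1 ≤ k) (j : Fin n) :
    ContDiffAt ℝ m (dZ n f j) z :=
  contDiffAt_const.mul ((hf.fderiv_apply_const hmk _).sub
    (contDiffAt_const.mul (hf.fderiv_apply_const hmk _)))

lemma ContDiffAt.dZb {f : Pt n → ℂ} {z : Pt n} {m k : WithTop ℕ∞}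
    (hf : ContDiffAt ℝ k f z) (hmk : m + 1 ≤ k) (j : Fin n) :
    ContDiffAt ℝ m (dZb n f j) z :=
  contDiffAt_const.mul ((hf.fderiv_apply_const hmk _).add
    (contDiffAt_const.mul (hf.fderiv_apply_const hmk _)))

lemma fderiv_fderiv_apply_comm {f : Pt n → ℂ} {z : Pt n} (hf : ContDiffAt ℝ 2 f z)
    (v w : Pt n) :
    fderiv ℝ (fun y => fderiv ℝ f y v) z w = fderiv ℝ (fun y => fderiv ℝ f y w) z v := by
  have hd : DifferentiableAt ℝ (fderiv ℝ f) z :=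
    (hf.fderiv_right (m := 1) (by norm_num)).differentiableAt (by norm_num)
  have hs : IsSymmSndFDerivAt ℝ f z := hf.isSymmSndFDerivAt (by simp)
  rw [fderiv_clm_apply hd (differentiableAt_const v), fderiv_clm_apply hd (differentiableAt_const w)]
  simpa using hs w v

/-- A complex constant-coefficient combination of two directional derivatives. -/
lemma fderiv_linear_combination {f g : Pt n → ℂ} {z : Pt n} (hf : DifferentiableAt ℝ f z)
    (hg : DifferentiableAt ℝ g z) (b c : ℂ) (v : Pt n) :
    fderiv ℝ (fun w => b * (f w + c * g w)) z v
      = b * (fderiv ℝ f z v + c * fderiv ℝ g z v) := by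
  rw [fderiv_const_mul (hf.fun_add (hg.const_mul c)), fderiv_fun_add hf (hg.const_mul c),
    fderiv_const_mul hg]
  simp [mul_add]

lemma dZ_dZ_comm {f : Pt n → ℂ} {z : Pt n} (hf : ContDiffAt ℝ 2 f z) (j k : Fin n) :
    dZ n (dZ n f k) j z = dZ n (dZ n f j) k z := by
  have hd : ∀ v, DifferentiableAt ℝ (fun w => fderiv ℝ f w v) z := fun v =>
    (hf.fderiv_apply_const (m := 1) (by norm_num) v).differentiableAt (by norm_num)
  have e : ∀ k, dZ n f k = fun w => (1 / 2 : ℂ) * (fderiv ℝ f w (Pi.single k 1)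
      + (-Complex.I) * fderiv ℝ f w (Pi.single k Complex.I)) := by
    intro k; ext w; simp only [dZ]; ring
  rw [e k, e j]
  simp only [dZ]
  rw [fderiv_linear_combination (hd _) (hd _), fderiv_linear_combination (hd _) (hd _),
    fderiv_linear_combination (hd _) (hd _), fderiv_linear_combination (hd _) (hd _),
    fderiv_fderiv_apply_comm hf (Pi.single k 1) (Pi.single j 1),
    fderiv_fderiv_apply_comm hf (Pi.single k 1) (Pi.single j Complex.I),
    fderiv_fderiv_apply_comm hf (Pi.single k Complex.I) (Pi.single j 1),
    fderiv_fderiv_apply_comm hf (Pi.single k Complex.I) (Pi.single j Complex.I)]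
  ring

lemma dZ_dZb_comm {f : Pt n → ℂ} {z : Pt n} (hf : ContDiffAt ℝ 2 f z) (j k : Fin n) :
    dZ n (dZb n f k) j z = dZb n (dZ n f j) k z := by
  have hd : ∀ v, DifferentiableAt ℝ (fun w => fderiv ℝ f w v) z := fun v =>
    (hf.fderiv_apply_const (m := 1) (by norm_num) v).differentiableAt (by norm_num)
  have e : dZ n f j = fun w => (1 / 2 : ℂ) * (fderiv ℝ f w (Pi.single j 1)
      + (-Complex.I) * fderiv ℝ f w (Pi.single j Complex.I)) := by
    ext w; simp only [dZ]; ring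
  have e' : dZb n f k = fun w => (1 / 2 : ℂ) * (fderiv ℝ f w (Pi.single k 1)
      + Complex.I * fderiv ℝ f w (Pi.single k Complex.I)) := rfl
  rw [e, e']
  simp only [dZ, dZb]
  rw [fderiv_linear_combination (hd _) (hd _), fderiv_linear_combination (hd _) (hd _),
    fderiv_linear_combination (hd _) (hd _), fderiv_linear_combination (hd _) (hd _),
    fderiv_fderiv_apply_comm hf (Pi.single k 1) (Pi.single j 1),
    fderiv_fderiv_apply_comm hf (Pi.single k 1) (Pi.single j Complex.I),
    fderiv_fderiv_apply_comm hf (Pi.single k Complex.I) (Pi.single j 1),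
    fderiv_fderiv_apply_comm hf (Pi.single k Complex.I) (Pi.single j Complex.I)]
  ring

/-- The complex Hessian of a real-valued `C²` function is Hermitian. -/
lemma conj_dZ_dZb_cR {ρ : Pt n → ℝ} {z : Pt n} (hρ : ContDiffAt ℝ 2 (cR n ρ) z)
    (j k : Fin n) :
    (starRingEnd ℂ) (dZ n (dZb n (cR n ρ) k) j z) = dZ n (dZb n (cR n ρ) j) k z := by
  rw [conj_dZ, dZ_dZb_comm hρ]
  simp only [conj_dZb_cR]

lemma dZ_cR_ne_zero {ρ : Pt n → ℝ} {z : Pt n} (hd : DifferentiableAt ℝ ρ z)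
    (h : fderiv ℝ ρ z ≠ 0) : ∃ j, dZ n (cR n ρ) j z ≠ 0 := by
  by_contra! hall
  apply h
  have hc : ∀ v, fderiv ℝ (cR n ρ) z v = (fderiv ℝ ρ z v : ℂ) := by
    intro v
    have : HasFDerivAt (cR n ρ) (Complex.ofRealCLM.comp (fderiv ℝ ρ z)) z :=
      Complex.ofRealCLM.hasFDerivAt.comp z hd.hasFDerivAt
    rw [this.fderiv]
    simp
  have h1 : ∀ j, fderiv ℝ ρ z (Pi.single j 1) = 0 ∧ fderiv ℝ ρ z (Pi.single j Complex.I) = 0 := by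
    intro j
    have := hall j
    simp only [dZ, hc] at this
    have hre := congrArg Complex.re this
    have him := congrArg Complex.im this
    simp at hre him
    exact ⟨hre, him⟩
  ext v
  have hv : v = ∑ j, ((v j).re • (Pi.single j 1 : Pt n) + (v j).im • (Pi.single j Complex.I : Pt n)) := by
    ext j
    simp [Finset.sum_apply, Pi.single_apply, Finset.sum_add_distrib]
  rw [hv]
  simp [h1]

lemma gradSq_pos {ρ : Pt n → ℝ} {z : Pt n} (h : ∃ j, dZ n (cR n ρ) j z ≠ 0) :
    0 < gradSq n ρ z := by
  obtain ⟨j, hj⟩ := h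
  exact Finset.sum_pos' (fun _ _ => Complex.normSq_nonneg _)
    ⟨j, Finset.mem_univ j, Complex.normSq_pos.2 hj⟩

lemma gradSq_eq_sum_mul (ρ : Pt n → ℝ) (z : Pt n) :
    (gradSq n ρ z : ℂ) = ∑ j, dZb n (cR n ρ) j z * dZ n (cR n ρ) j z := by
  simp only [gradSq, Complex.ofReal_sum, Complex.normSq_eq_conj_mul_self, conj_dZ_cR]

end Wirtinger

section Hermitian

variable {n : ℕ}

/-- Cauchy-Schwarz for a Hermitian form that is positive semidefinite on the hyperplane
`∑ X_j r_j = 0`: a null vector of the form lies in its kernel. -/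
lemma sesq_eq_zero_of_null {h : Fin n → Fin n → ℂ}
    (hherm : ∀ j k, (starRingEnd ℂ) (h j k) = h k j) {r a X : Fin n → ℂ}
    (hpos : ∀ Y : Fin n → ℂ, ∑ j, Y j * r j = 0 →
      0 ≤ (∑ j, ∑ k, h j k * Y j * (starRingEnd ℂ) (Y k)).re)
    (ha : ∑ j, a j * r j = 0) (hX : ∑ j, X j * r j = 0)
    (hnull : ∑ j, ∑ k, h j k * a j * (starRingEnd ℂ) (a k) = 0) :
    ∑ j, ∑ k, h j k * X j * (starRingEnd ℂ) (a k) = 0 := by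
  set B := ∑ j, ∑ k, h j k * X j * (starRingEnd ℂ) (a k) with hB
  set C := ∑ j, ∑ k, h j k * X j * (starRingEnd ℂ) (X k) with hC
  have hBc : ∑ j, ∑ k, h j k * a j * (starRingEnd ℂ) (X k) = (starRingEnd ℂ) B := by
    rw [hB, Finset.sum_comm]
    simp only [map_sum, map_mul, hherm, Complex.conj_conj]
    exact Finset.sum_congr rfl fun j _ => Finset.sum_congr rfl fun k _ => by ring
  have expand : ∀ t : ℂ, ∑ j, ∑ k, h j k * (a j + t * X j) * (starRingEnd ℂ) (a k + t * X k)
      = t * B + (starRingEnd ℂ) t * (starRingEnd ℂ) B + t * (starRingEnd ℂ) t * C := by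
    intro t
    rw [← hBc, hB, hC, ← zero_add (t * _), ← hnull]
    simp only [Finset.mul_sum, ← Finset.sum_add_distrib, map_add, map_mul]
    exact Finset.sum_congr rfl fun j _ => Finset.sum_congr rfl fun k _ => by ring
  have key : ∀ s : ℝ, 0 ≤ Complex.normSq B * (-2 * s + s ^ 2 * C.re) := by
    intro s
    have := hpos (fun j => a j + (-s * (starRingEnd ℂ) B) * X j) (by
      simp only [add_mul, Finset.sum_add_distrib, ha, mul_assoc, ← Finset.mul_sum, hX]
      simp)
    rw [expand] at this
    convert this using 1
    simp [Complex.normSq_apply]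
    ring
  by_contra hne
  have hBpos : 0 < Complex.normSq B := Complex.normSq_pos.2 hne
  have h1 := key (1 / (|C.re| + 1))
  have hc : 0 < |C.re| + 1 := by positivity
  have h2 : -2 * (1 / (|C.re| + 1)) + (1 / (|C.re| + 1)) ^ 2 * C.re < 0 := by
    have : -2 * (1 / (|C.re| + 1)) + (1 / (|C.re| + 1)) ^ 2 * C.re
        = (-2 * (|C.re| + 1) + C.re) / (|C.re| + 1) ^ 2 := by
      field_simp
    rw [this]
    apply div_neg_of_neg_of_pos _ (by positivity)
    linarith [le_abs_self C.re, abs_nonneg C.re]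
  nlinarith [mul_neg_of_pos_of_neg hBpos h2]

/-- A null vector `a` of a form as in `sesq_eq_zero_of_null` pairs to a multiple of `r`. -/
lemma sesq_null_proportional {h : Fin n → Fin n → ℂ}
    (hherm : ∀ j k, (starRingEnd ℂ) (h j k) = h k j) {r a u : Fin n → ℂ}
    (hpos : ∀ Y : Fin n → ℂ, ∑ j, Y j * r j = 0 →
      0 ≤ (∑ j, ∑ k, h j k * Y j * (starRingEnd ℂ) (Y k)).re)
    (ha : ∑ j, a j * r j = 0) (hu : ∑ j, u j * r j = 1)
    (hnull : ∑ j, ∑ k, h j k * a j * (starRingEnd ℂ) (a k) = 0) (m : Fin n) :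
    ∑ k, h m k * (starRingEnd ℂ) (a k)
      = (∑ j, ∑ k, h j k * u j * (starRingEnd ℂ) (a k)) * r m := by
  have key := sesq_eq_zero_of_null hherm (X := fun j => (Pi.single m 1 : Fin n → ℂ) j - r m * u j) hpos ha
    (by
      simp only [sub_mul, Finset.sum_sub_distrib, mul_assoc, ← Finset.mul_sum, hu]
      simp [Pi.single_apply]) hnull
  have e : ∑ j, ∑ k, h j k * ((Pi.single m 1 : Fin n → ℂ) j - r m * u j) * (starRingEnd ℂ) (a k)
      = ∑ k, h m k * (starRingEnd ℂ) (a k)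
        - (∑ j, ∑ k, h j k * u j * (starRingEnd ℂ) (a k)) * r m := by
    simp only [mul_sub, sub_mul, Finset.sum_sub_distrib]
    congr 1
    · rw [Finset.sum_eq_single m] <;> simp +contextual
    · simp only [Finset.sum_mul]
      exact Finset.sum_congr rfl fun j _ => Finset.sum_congr rfl fun k _ => by ring
  exact sub_eq_zero.1 (e.symm.trans key)

/-- The tensor identity behind `levi_N_eq_covariant`: `Da`, `Dab`, `Du`, `R` and `T` are the
derivatives of `a`, `ab`, `u`, `r` and `h`. -/
lemma levi_derivative_identity {h R Da Dab Du : Fin n → Fin n → ℂ}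
    {T : Fin n → Fin n → Fin n → ℂ} {r rb a ab u : Fin n → ℂ} {lam lamb : ℂ}
    (hu : ∑ m, u m * r m = 1)
    (hl : ∀ m, ∑ k, h m k * ab k = lam * r m)
    (hr : ∀ k, ∑ j, h j k * a j = lamb * rb k)
    (htan : ∀ m, ∑ j, (Da m j * r j + a j * R m j) = 0)
    (htanb : ∀ m, ∑ k, (Dab m k * rb k + ab k * h m k) = 0)
    (hDu : ∀ l, ∑ m, (Du l m * r m + u m * R l m) = 0)
    (hR : ∀ l m, R l m = R m l) (hT : ∀ l m j, T l m j = T m l j) :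
    lam * lamb + ∑ m, u m * ∑ j, ∑ k,
        ((T m j k * a j + h j k * Da m j) * ab k + h j k * a j * Dab m k)
      = ∑ j, (∑ l, a l * ∑ m, (Du l m * h m j + u m * T l m j)) * ab j := by
  have hA : ∀ m, ∑ j, ∑ k, ((T m j k * a j + h j k * Da m j) * ab k + h j k * a j * Dab m k)
      = ∑ j, ∑ k, T m j k * a j * ab k - lam * ∑ j, a j * R m j - lam * lamb * r m := by
    intro m
    have e1 : ∑ j, ∑ k, h j k * Da m j * ab k = - (lam * ∑ j, a j * R m j) := by
      have h1 : ∑ j, Da m j * r j = - ∑ j, a j * R m j := by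
        have := htan m
        rw [Finset.sum_add_distrib] at this
        exact eq_neg_of_add_eq_zero_left this
      rw [← mul_neg, ← h1, Finset.mul_sum]
      refine Finset.sum_congr rfl fun j _ => ?_
      rw [show lam * (Da m j * r j) = Da m j * (lam * r j) by ring, ← hl, Finset.mul_sum]
      exact Finset.sum_congr rfl fun k _ => by ring
    have e2 : ∑ j, ∑ k, h j k * a j * Dab m k = - (lam * lamb * r m) := by
      have h1 : ∑ k, Dab m k * rb k = - (lam * r m) := by
        have := htanb m
        rw [Finset.sum_add_distrib] at this
        rw [eq_neg_of_add_eq_zero_left this, ← hl]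
        exact congrArg _ (Finset.sum_congr rfl fun k _ => mul_comm _ _)
      rw [show -(lam * lamb * r m) = lamb * -(lam * r m) by ring, ← h1, Finset.sum_comm,
        Finset.mul_sum]
      refine Finset.sum_congr rfl fun k _ => ?_
      rw [← Finset.sum_mul, hr]
      ring
    simp only [add_mul, Finset.sum_add_distrib, e1, e2]
    ring
  have hB : ∑ j, (∑ l, a l * ∑ m, (Du l m * h m j + u m * T l m j)) * ab j
      = ∑ l, a l * (lam * ∑ m, Du l m * r m)
        + ∑ m, u m * ∑ j, ∑ k, T m j k * a j * ab k := by
    have e1 : ∀ l, lam * ∑ m, Du l m * r m = ∑ j, ∑ m, Du l m * h m j * ab j := by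
      intro l
      rw [Finset.sum_comm, Finset.mul_sum]
      refine Finset.sum_congr rfl fun m _ => ?_
      rw [show lam * (Du l m * r m) = Du l m * (lam * r m) by ring, ← hl, Finset.mul_sum]
      exact Finset.sum_congr rfl fun k _ => by ring
    have e2 : ∑ m, u m * ∑ l, ∑ j, T m l j * a l * ab j
        = ∑ l, a l * ∑ j, ∑ m, u m * T l m j * ab j := by
      simp only [Finset.mul_sum]
      rw [Finset.sum_comm]
      refine Finset.sum_congr rfl fun l _ => ?_
      rw [Finset.sum_comm]
      exact Finset.sum_congr rfl fun j _ => Finset.sum_congr rfl fun m _ => by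
        rw [hT l m j]; ring
    rw [e2]
    simp only [e1, ← Finset.sum_add_distrib, ← mul_add, Finset.sum_mul]
    rw [Finset.sum_comm]
    refine Finset.sum_congr rfl fun l _ => ?_
    rw [Finset.mul_sum]
    refine Finset.sum_congr rfl fun j _ => ?_
    rw [mul_assoc, Finset.sum_mul]
    simp only [add_mul]
  have hC : ∑ l, a l * (lam * ∑ m, Du l m * r m) = - (lam * ∑ m, u m * ∑ j, a j * R m j) := by
    have h1 : ∀ l, ∑ m, Du l m * r m = - ∑ m, u m * R l m := by
      intro l
      have := hDu l
      rw [Finset.sum_add_distrib] at this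
      exact eq_neg_of_add_eq_zero_left this
    simp only [h1, Finset.mul_sum, ← Finset.sum_neg_distrib]
    rw [Finset.sum_comm]
    exact Finset.sum_congr rfl fun m _ => Finset.sum_congr rfl fun l _ => by
      rw [hR l m]; ring
  have hD : ∑ m, u m * (lam * lamb * r m) = lam * lamb := by
    calc ∑ m, u m * (lam * lamb * r m) = lam * lamb * ∑ m, u m * r m := by
          rw [Finset.mul_sum]
          exact Finset.sum_congr rfl fun m _ => by ring
      _ = lam * lamb := by rw [hu, mul_one]
  have hE : ∑ m, u m * (lam * ∑ j, a j * R m j) = lam * ∑ m, u m * ∑ j, a j * R m j := by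
    rw [Finset.mul_sum]
    exact Finset.sum_congr rfl fun m _ => by ring
  rw [hB, hC]
  simp only [hA, mul_sub, Finset.sum_sub_distrib, hD, hE]
  ring

end Hermitian

/-- Lemma 4.5: at Levi-degenerate boundary points,
|Levi_ρ(L,N)|²/‖∇ρ‖² + (1/2) N(Levi_ρ(L,L))/‖∇ρ‖ = (1/4) g(∇_L ∇_{L_n} ∇ρ, L). -/
theorem levi_N_eq_covariant
    (n k : ℕ) (hn : 2 ≤ n) (hk : 3 ≤ k)
    (Ω : Set (Pt n)) (hopen : IsOpen Ω) (hconn : IsConnected Ω)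
    (hbdd : Bornology.IsBounded Ω)
    (ρ : Pt n → ℝ) (V : Set (Pt n)) (hdef : IsDefining n (k : ℕ∞) Ω ρ V)
    (hpsc : LeviPseudoconvex n ρ Ω)
    (U : Set (Pt n)) (hU : IsOpen U) (hUfr : frontier Ω ⊆ U)
    (a : Pt n → Fin n → ℂ)
    (hsm : ∀ j, ContDiffOn ℝ (⊤ : ℕ∞) (fun w => a w j) U)
    (htan : ∀ z ∈ U, ∑ j, a z j * dZ n (cR n ρ) j z = 0)
    (p : Pt n) (hp : p ∈ frontier Ω)
    (h0 : levi n ρ p (a p) (a p) = 0) :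
    ((Complex.normSq (levi n ρ p (a p) ((NVF n ρ).a p)) / (gradNorm n ρ p) ^ 2 : ℝ) : ℂ)
      + (1 / 2 : ℂ) * VF.app (NVF n ρ) (fun w => levi n ρ w (a w) (a w)) p /
          (gradNorm n ρ p : ℂ)
    = (1 / 4 : ℂ) *
        gMet ((covD (⟨a, fun _ _ => 0⟩ : VF n) (covD (LnVF n ρ) (gradVF n ρ))).atPt p)
          (a p, 0) := by
  obtain ⟨hVo, hcl, hρV, -, hne⟩ := hdef
  have hpV : p ∈ V := hcl (frontier_subset_closure hp)
  have hpU : U ∈ nhds p := hU.mem_nhds (hUfr hp)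
  have hρ3 : ContDiffAt ℝ 3 ρ p :=
    (hρV.contDiffAt (hVo.mem_nhds hpV)).of_le (WithTop.coe_le_coe.2 (Nat.cast_le.2 hk))
  have hf3 : ContDiffAt ℝ 3 (cR n ρ) p := Complex.ofRealCLM.contDiff.contDiffAt.comp p hρ3
  have hf2 : ContDiffAt ℝ 2 (cR n ρ) p := hf3.of_le (by norm_num)
  have hr2 : ∀ j, ContDiffAt ℝ 2 (dZ n (cR n ρ) j) p := fun j => hf3.dZ (by norm_num) j
  have hrb2 : ∀ j, ContDiffAt ℝ 2 (dZb n (cR n ρ) j) p := fun j => hf3.dZb (by norm_num) j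
  have hrd : ∀ j, DifferentiableAt ℝ (dZ n (cR n ρ) j) p := fun j =>
    (hr2 j).differentiableAt (by norm_num)
  have hrbd : ∀ j, DifferentiableAt ℝ (dZb n (cR n ρ) j) p := fun j =>
    (hrb2 j).differentiableAt (by norm_num)
  have hhd : ∀ j k, DifferentiableAt ℝ (dZ n (dZb n (cR n ρ) k) j) p := fun j k =>
    ((hrb2 k).dZ (m := 1) (by norm_num) j).differentiableAt (by norm_num)
  have had : ∀ j, DifferentiableAt ℝ (fun w => a w j) p := fun j =>
    ((hsm j).contDiffAt hpU).differentiableAt (by simp)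
  have habd : ∀ j, DifferentiableAt ℝ (fun w => (starRingEnd ℂ) (a w j)) p := fun j =>
    Complex.conjCLE.differentiableAt.comp p (had j)
  have hGpos : 0 < gradSq n ρ p :=
    gradSq_pos (dZ_cR_ne_zero (hρ3.differentiableAt (by norm_num)) (hne p hp))
  have hGne : (gradSq n ρ p : ℂ) ≠ 0 := by exact_mod_cast hGpos.ne'
  have hGd : DifferentiableAt ℝ (fun w => (gradSq n ρ w : ℂ)) p := by
    simp only [gradSq_eq_sum_mul]
    exact DifferentiableAt.fun_sum fun j _ => (hrbd j).mul (hrd j)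
  have hud : ∀ m, DifferentiableAt ℝ (fun w => (LnVF n ρ).a w m) p := fun m =>
    (hrbd m).mul (hGd.inv hGne)
  have hnorm : ∀ᶠ w in nhds p, ∑ m, (LnVF n ρ).a w m * dZ n (cR n ρ) m w = 1 := by
    filter_upwards [hGd.continuousAt.eventually_ne hGne] with w hw
    simp only [LnVF, div_mul_eq_mul_div, ← Finset.sum_div, ← gradSq_eq_sum_mul]
    exact div_self hw
  have hherm := fun j k => conj_dZ_dZb_cR hf2 j k
  have htanp := htan p (mem_of_mem_nhds hpU)
  set lam : ℂ := ∑ j, ∑ k, dZ n (dZb n (cR n ρ) k) j p * (LnVF n ρ).a p j *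
    (starRingEnd ℂ) (a p k)
  have hl : ∀ m, ∑ k, dZ n (dZb n (cR n ρ) k) m p * (starRingEnd ℂ) (a p k)
      = lam * dZ n (cR n ρ) m p := fun m =>
    sesq_null_proportional hherm (hpsc p hp) htanp hnorm.self_of_nhds h0 m
  have hr : ∀ k, ∑ j, dZ n (dZb n (cR n ρ) k) j p * a p j
      = (starRingEnd ℂ) lam * dZb n (cR n ρ) k p := by
    intro k
    have := congrArg (starRingEnd ℂ) (hl k)
    simpa only [map_sum, map_mul, hherm, Complex.conj_conj, conj_dZ_cR] using this
  have hDtan : ∀ m, ∑ j, (dZ n (fun w => a w j) m p * dZ n (cR n ρ) j p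
      + a p j * dZ n (dZ n (cR n ρ) j) m p) = 0 := by
    intro m
    have e := dZ_congr (g := fun _ => (0 : ℂ)) (Filter.eventually_of_mem hpU htan) m
    rw [dZ_const, dZ_sum _ fun j _ => (had j).fun_mul (hrd j)] at e
    simpa only [dZ_mul (had _) (hrd _)] using e
  have hDtanb : ∀ m, ∑ k, (dZ n (fun w => (starRingEnd ℂ) (a w k)) m p * dZb n (cR n ρ) k p
      + (starRingEnd ℂ) (a p k) * dZ n (dZb n (cR n ρ) k) m p) = 0 := by
    intro m
    have hc : ∀ z ∈ U, ∑ k, (starRingEnd ℂ) (a z k) * dZb n (cR n ρ) k z = 0 := by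
      intro z hz
      simpa only [map_sum, map_mul, conj_dZ_cR, map_zero]
        using congrArg (starRingEnd ℂ) (htan z hz)
    have e := dZ_congr (g := fun _ => (0 : ℂ)) (Filter.eventually_of_mem hpU hc) m
    rw [dZ_const, dZ_sum _ fun j _ => (habd j).fun_mul (hrbd j)] at e
    simpa only [dZ_mul (habd _) (hrbd _)] using e
  have hDu : ∀ l, ∑ m, (dZ n (fun w => (LnVF n ρ).a w m) l p * dZ n (cR n ρ) m p
      + (LnVF n ρ).a p m * dZ n (dZ n (cR n ρ) m) l p) = 0 := by
    intro l
    have e := dZ_congr (g := fun _ => (1 : ℂ)) hnorm l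
    rw [dZ_const, dZ_sum _ fun j _ => (hud j).fun_mul (hrd j)] at e
    simpa only [dZ_mul (hud _) (hrd _)] using e
  have key := levi_derivative_identity
    (T := fun m j k => dZ n (dZ n (dZb n (cR n ρ) k) j) m p)
    (R := fun l m => dZ n (dZ n (cR n ρ) m) l p) hnorm.self_of_nhds hl hr hDtan hDtanb hDu
    (fun l m => dZ_dZ_comm hf2 l m) (fun l m j => dZ_dZ_comm (hrb2 j) l m)
  have hlevi : ∀ m, dZ n (fun w => levi n ρ w (a w) (a w)) m p = ∑ j, ∑ k,
      ((dZ n (dZ n (dZb n (cR n ρ) k) j) m p * a p j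
          + dZ n (dZb n (cR n ρ) k) j p * dZ n (fun w => a w j) m p) * (starRingEnd ℂ) (a p k)
        + dZ n (dZb n (cR n ρ) k) j p * a p j
          * dZ n (fun w => (starRingEnd ℂ) (a w k)) m p) := by
    intro m
    have hd : ∀ j k, DifferentiableAt ℝ (fun w => dZ n (dZb n (cR n ρ) k) j w * a w j *
        (starRingEnd ℂ) (a w k)) p := fun j k => ((hhd j k).mul (had j)).mul (habd k)
    simp only [levi]
    rw [dZ_sum _ fun j _ => DifferentiableAt.fun_sum fun k _ => hd j k]
    refine Finset.sum_congr rfl fun j _ => ?_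
    rw [dZ_sum _ fun k _ => hd j k]
    refine Finset.sum_congr rfl fun k _ => ?_
    rw [dZ_mul ((hhd j k).fun_mul (had j)) (habd k), dZ_mul (hhd j k) (had j)]
  have hcov : ∀ j l, dZ n (fun w => (covD (LnVF n ρ) (gradVF n ρ)).a w j) l p
      = 2 * ∑ m, (dZ n (fun w => (LnVF n ρ).a w m) l p * dZ n (dZb n (cR n ρ) j) m p
        + (LnVF n ρ).a p m * dZ n (dZ n (dZb n (cR n ρ) j) m) l p) := by
    intro j l
    have hnear : ∀ᶠ w in nhds p, (covD (LnVF n ρ) (gradVF n ρ)).a w j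
        = 2 * ∑ m, (LnVF n ρ).a w m * dZ n (dZb n (cR n ρ) j) m w := by
      filter_upwards [(hrb2 j).eventually (by simp)] with w hw
      have : ∀ m, dZ n (fun v => 2 * dZb n (cR n ρ) j v) m w
          = 2 * dZ n (dZb n (cR n ρ) j) m w := fun m =>
        dZ_const_mul 2 (hw.differentiableAt (by norm_num)) m
      simp only [covD, VF.app, gradVF, this, Finset.mul_sum]
      simp [LnVF, mul_left_comm]
    have hd : ∀ m, DifferentiableAt ℝ
        (fun w => (LnVF n ρ).a w m * dZ n (dZb n (cR n ρ) j) m w) p := fun m =>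
      (hud m).mul (hhd m j)
    rw [dZ_congr hnear, dZ_const_mul 2 (DifferentiableAt.fun_sum fun m _ => hd m),
      dZ_sum _ fun m _ => hd m]
    simp only [dZ_mul (hud _) (hhd _ _)]
  set s : ℝ := Real.sqrt (gradSq n ρ p) with hs
  have hspos : 0 < s := Real.sqrt_pos.2 hGpos
  have hsne : (s : ℂ) ≠ 0 := by exact_mod_cast hspos.ne'
  have hss : (s : ℂ) * s = gradSq n ρ p := by exact_mod_cast Real.mul_self_sqrt hGpos.le
  have hN : ∀ m, (NVF n ρ).a p m = s * (LnVF n ρ).a p m := by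
    intro m
    simp only [NVF, LnVF, ← hs, ← hss]
    field_simp
  have hleviN : levi n ρ p (a p) ((NVF n ρ).a p) = s * (starRingEnd ℂ) lam := by
    simp only [levi, hN, lam, map_sum, map_mul, hherm, Complex.conj_conj, Complex.conj_ofReal,
      Finset.mul_sum]
    rw [Finset.sum_comm]
    exact Finset.sum_congr rfl fun j _ => Finset.sum_congr rfl fun k _ => by ring
  have hfirst : ((Complex.normSq (levi n ρ p (a p) ((NVF n ρ).a p))
      / (gradNorm n ρ p) ^ 2 : ℝ) : ℂ) = (1 / 4 : ℂ) * (lam * (starRingEnd ℂ) lam) := by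
    rw [hleviN, Complex.mul_conj]
    simp only [gradNorm, ← hs, map_mul, Complex.normSq_conj, Complex.normSq_ofReal]
    push_cast
    field_simp
    ring
  have hsecond : VF.app (NVF n ρ) (fun w => levi n ρ w (a w) (a w)) p
      = s * ∑ m, (LnVF n ρ).a p m * dZ n (fun w => levi n ρ w (a w) (a w)) m p := by
    simp only [VF.app, hN, Finset.mul_sum]
    simp [NVF, mul_assoc]
  have hright : gMet ((covD (⟨a, fun _ _ => 0⟩ : VF n)
      (covD (LnVF n ρ) (gradVF n ρ))).atPt p) (a p, 0)
      = ∑ j, (∑ l, a p l * ∑ m, (dZ n (fun w => (LnVF n ρ).a w m) l p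
          * dZ n (dZb n (cR n ρ) j) m p
        + (LnVF n ρ).a p m * dZ n (dZ n (dZb n (cR n ρ) j) m) l p))
          * (starRingEnd ℂ) (a p j) := by
    have e : ∀ j, (covD (⟨a, fun _ _ => 0⟩ : VF n) (covD (LnVF n ρ) (gradVF n ρ))).a p j
        = 2 * ∑ l, a p l * ∑ m, (dZ n (fun w => (LnVF n ρ).a w m) l p
          * dZ n (dZb n (cR n ρ) j) m p
        + (LnVF n ρ).a p m * dZ n (dZ n (dZb n (cR n ρ) j) m) l p) := by
      intro j
      rw [Finset.mul_sum, show (covD (⟨a, fun _ _ => 0⟩ : VF n)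
        (covD (LnVF n ρ) (gradVF n ρ))).a p j
        = VF.app ⟨a, fun _ _ => 0⟩ (fun w => (covD (LnVF n ρ) (gradVF n ρ)).a w j) p from rfl]
      simp only [VF.app, hcov, zero_mul, Finset.sum_const_zero, add_zero]
      exact Finset.sum_congr rfl fun l _ => by ring
    simp only [gMet, VF.atPt, e, Pi.zero_apply, map_zero, mul_zero, Finset.sum_const_zero,
      add_zero, mul_assoc, ← Finset.mul_sum]
    ring
  rw [hfirst, hsecond, hright, ← key]
  simp only [hlevi, gradNorm, ← hs]
  push_cast
  field_simp
  ring
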